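/- The asymptotic period of a simple Markov chain X satisfies d(X) = sup{β(X^(m)) : m ≥ 1}. -/

import Mathlib

open MeasureTheory Filter Set ProbabilityTheory

/-- A discrete-time Markov chain on a state space `S`: a stochastic transition
matrix `P`, an initial distribution `init`, and the induced probability measure
`μ` on the path space `ℕ → S`, determined by its values on cylinder sets. -/
structure MarkovChain (S : Type) [MeasurableSpace S] where
  P : S → S → ℝ
  P_nonneg : ∀ i j, 0 ≤ P i j
  P_stochastic : ∀ i, HasSum (P i) 1
  init : S → ℝ
  init_nonneg : ∀ i, 0 ≤ init i
  init_hasSum : HasSum init 1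
  μ : Measure (ℕ → S)
  μ_prob : IsProbabilityMeasure μ
  μ_cylinder : ∀ (n : ℕ) (s : ℕ → S),
    μ {ω | ∀ k ≤ n, ω k = s k}
      = ENNReal.ofReal (init (s 0) * ∏ k ∈ Finset.range n, P (s k) (s (k + 1)))

namespace MarkovChain

variable {S : Type} [MeasurableSpace S]

open Classical in
/-- The `n`-step transition probabilities `P^n(i,j)`. -/
noncomputable def Pn (X : MarkovChain S) : ℕ → S → S → ℝ
  | 0, i, j => if i = j then 1 else 0
  | n + 1, i, j => ∑' k : S, X.Pn n i k * X.P k j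

/-- Irreducibility: every state can be reached from every state. -/
def Irreducible (X : MarkovChain S) : Prop := ∀ i j : S, ∃ n : ℕ, 0 < X.Pn n i j

/-- Aperiodicity: for each state, the gcd of the set `{n ≥ 1 | P^n(i,i) > 0}`
is `1` (expressed via common divisors). -/
def Aperiodic (X : MarkovChain S) : Prop :=
  ∀ i : S, ∀ d : ℕ, (∀ n : ℕ, 0 < n → 0 < X.Pn n i i → d ∣ n) → d = 1

/-- `U^(m)(C)`: the event that the `m`-step chain visits `C` infinitely often. -/
def U (X : MarkovChain S) (m : ℕ) (C : Set S) : Set (ℕ → S) :=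
  {ω | ∀ n : ℕ, ∃ k : ℕ, n ≤ k ∧ ω (k * m) ∈ C}

/-- `L^(m)(C)`: the event that the `m`-step chain is eventually in `C`. -/
def L (X : MarkovChain S) (m : ℕ) (C : Set S) : Set (ℕ → S) :=
  {ω | ∃ n : ℕ, ∀ k : ℕ, n ≤ k → ω (k * m) ∈ C}

/-- `C` is transient with respect to the `m`-step chain `X^(m)`. -/
def Transient (X : MarkovChain S) (m : ℕ) (C : Set S) : Prop := X.μ (X.U m C) = 0

/-- `C` is regular with respect to `X^(m)`: `U^(m)(C)` and `L^(m)(C)` agree up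
to a null event. -/
def Regular (X : MarkovChain S) (m : ℕ) (C : Set S) : Prop :=
  X.μ (symmDiff (X.U m C) (X.L m C)) = 0

/-- `C` is almost closed with respect to `X^(m)`: regular but not transient. -/
def AlmostClosed (X : MarkovChain S) (m : ℕ) (C : Set S) : Prop :=
  X.Regular m C ∧ ¬ X.Transient m C

/-- An almost closed set is atomic if it does not contain two disjoint almost
closed subsets. -/
def Atomic (X : MarkovChain S) (m : ℕ) (C : Set S) : Prop :=
  X.AlmostClosed m C ∧
    ¬ ∃ A B : Set S, A ⊆ C ∧ B ⊆ C ∧ Disjoint A B ∧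
      X.AlmostClosed m A ∧ X.AlmostClosed m B

/-- A Blackwell decomposition for the `m`-step chain `X^(m)`: a countable
collection of pairwise disjoint almost closed sets, all atomic except at most
one, where a nonatomic member contains no atomic subsets and consists of
transient states, and such that the probabilities `μ(L^(m)(C))` sum to one. -/
structure IsBlackwell (X : MarkovChain S) (m : ℕ) (𝒞 : Set (Set S)) : Prop where
  countable : 𝒞.Countable
  almostClosed : ∀ C ∈ 𝒞, X.AlmostClosed m C
  disjoint : 𝒞.PairwiseDisjoint id
  atMostOneNonatomic : ∀ C₁ ∈ 𝒞, ∀ C₂ ∈ 𝒞, ¬ X.Atomic m C₁ → ¬ X.Atomic m C₂ → C₁ = C₂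
  nonatomicNoAtomicSubset : ∀ C ∈ 𝒞, ¬ X.Atomic m C → ∀ A : Set S, A ⊆ C → ¬ X.Atomic m A
  nonatomicTransientStates : ∀ C ∈ 𝒞, ¬ X.Atomic m C → ∀ i ∈ C, X.Transient m {i}
  sum_L_eq_one : ∑' C : 𝒞, X.μ (X.L m (C : Set S)) = 1

/-- `β(X^(m))`: the number of sets in a Blackwell decomposition for `X^(m)`
(well defined since the decomposition is unique up to equivalence). -/
noncomputable def beta (X : MarkovChain S) (m : ℕ) : ℕ∞ :=
  sInf (Set.encard '' {𝒞 : Set (Set S) | X.IsBlackwell m 𝒞})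

/-- `X` is simple if `β(X) = 1`. -/
def Simple (X : MarkovChain S) : Prop := X.beta 1 = 1

/-- The asymptotic period `d(X) = sup {m ≥ 1 | β(X^(m)) = m}` (possibly `∞`). -/
noncomputable def period (X : MarkovChain S) : ℕ∞ :=
  sSup {d : ℕ∞ | ∃ m : ℕ, 1 ≤ m ∧ X.beta m = (m : ℕ∞) ∧ d = (m : ℕ∞)}

/-- Recurrence: every state is visited infinitely often almost surely. -/
def Recurrent (X : MarkovChain S) : Prop := ∀ i : S, X.μ (X.U 1 {i}) = 1

end MarkovChain

/-- The shift operator `θ` on path space: `(θ ω)(n) = ω(n+1)`. -/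
def pathShift {S : Type} : (ℕ → S) → ℕ → S := fun ω n => ω (n + 1)

/-- An event `E` is `m`-invariant if its indicator function `f` satisfies
`f(ω) = f(θ^m ω)` for all paths `ω`. -/
def MInvariant {S : Type} (m : ℕ) (E : Set (ℕ → S)) : Prop :=
  ∀ ω : ℕ → S, ω ∈ E ↔ pathShift^[m] ω ∈ E

/-- A birth-death process: a Markov chain on `ℕ` with positive birth
probabilities `p_i = P(i,i+1)`, positive death probabilities `q_{i+1} = P(i+1,i)`,
all transition probabilities other than `p_i`, `q_i` and `r_i = P(i,i)` zero,
and at least one positive self-transition probability. -/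
structure MarkovChain.IsBirthDeath (X : MarkovChain ℕ) : Prop where
  birth_pos : ∀ i : ℕ, 0 < X.P i (i + 1)
  death_pos : ∀ i : ℕ, 0 < X.P (i + 1) i
  tridiagonal : ∀ i j : ℕ, 1 < |(i : ℤ) - (j : ℤ)| → X.P i j = 0
  self_pos : ∃ i : ℕ, 0 < X.P i i

/-- The `k`-fold shift on path space. -/
def pathShiftBy {S : Type} (k : ℕ) (ω : ℕ → S) : ℕ → S := fun n => ω (n + k)

/-- The paths which agree with `s` up to time `n`. -/
def pathCylinder {S : Type} (n : ℕ) (s : ℕ → S) : Set (ℕ → S) := {ω | ∀ k ≤ n, ω k = s k}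

/-- A measurable event which is invariant under the `m`-fold shift. -/
structure ShiftInvariant {S : Type} [MeasurableSpace S] (m : ℕ) (E : Set (ℕ → S)) : Prop where
  measurableSet : MeasurableSet E
  mem_iff : ∀ ω, pathShiftBy m ω ∈ E ↔ ω ∈ E

section PathSpace

variable {S : Type}

lemma pathShiftBy_pathShiftBy (a b : ℕ) (ω : ℕ → S) :
    pathShiftBy a (pathShiftBy b ω) = pathShiftBy (a + b) ω := by
  funext n
  simp [pathShiftBy, add_assoc]

lemma pathShiftBy_comm (a b : ℕ) (ω : ℕ → S) :
    pathShiftBy a (pathShiftBy b ω) = pathShiftBy b (pathShiftBy a ω) := by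
  rw [pathShiftBy_pathShiftBy, pathShiftBy_pathShiftBy, add_comm]

@[simp]
lemma pathShiftBy_zero (ω : ℕ → S) : pathShiftBy 0 ω = ω := rfl

lemma frestrictLe_preimage_singleton (n : ℕ) (s : ℕ → S) :
    Preorder.frestrictLe (π := fun _ : ℕ => S) n ⁻¹' {Preorder.frestrictLe n s}
      = pathCylinder n s := by
  ext ω
  simp [pathCylinder, funext_iff]

lemma exists_frestrictLe_eq (n : ℕ) (w : (i : Finset.Iic n) → S) :
    ∃ s : ℕ → S, Preorder.frestrictLe (π := fun _ : ℕ => S) n s = w := by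
  refine ⟨fun k => if h : k ≤ n then w ⟨k, Finset.mem_Iic.2 h⟩ else w ⟨0, by simp⟩, ?_⟩
  funext k
  have := Finset.mem_Iic.1 k.2
  simp [this]

/-- Splitting a path that starts with `s` and continues with `t` from time `n` on. -/
lemma pathCylinder_inter_shift (n k : ℕ) (s t : ℕ → S) (h : t 0 = s n) :
    pathCylinder n s ∩ pathShiftBy n ⁻¹' pathCylinder k t
      = pathCylinder (n + k) (fun j => if j < n then s j else t (j - n)) := by
  ext ω
  simp only [pathCylinder, pathShiftBy, mem_inter_iff, mem_ofPred_eq, mem_preimage]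
  constructor
  · rintro ⟨h1, h2⟩ j hj
    split_ifs with hjn
    · exact h1 j hjn.le
    · have := h2 (j - n) (by omega)
      rwa [Nat.sub_add_cancel (by omega)] at this
  · intro H
    refine ⟨fun j hj => ?_, fun j hj => ?_⟩
    · have := H j (by omega)
      split_ifs at this with hjn
      · exact this
      · obtain rfl : j = n := by omega
        simpa [h] using this
    · have := H (j + n) (by omega)
      simpa using this

variable [MeasurableSpace S]

@[fun_prop]
lemma measurable_pathShiftBy (k : ℕ) : Measurable (pathShiftBy (S := S) k) :=
  measurable_pi_lambda _ fun _ => measurable_pi_apply _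

lemma measurableSet_pathCylinder [MeasurableSingletonClass S] (n : ℕ) (s : ℕ → S) :
    MeasurableSet (pathCylinder n s) := by
  rw [← frestrictLe_preimage_singleton]
  exact Preorder.measurable_frestrictLe n (measurableSet_singleton _)

lemma measure_ext_of_pathCylinder [Countable S] [MeasurableSingletonClass S]
    {μ ν : Measure (ℕ → S)} [IsFiniteMeasure ν]
    (h : ∀ n s, μ (pathCylinder n s) = ν (pathCylinder n s)) : μ = ν := by
  have key : ∀ n, μ.map (Preorder.frestrictLe n) = ν.map (Preorder.frestrictLe n) := by
    intro n
    refine Measure.ext_of_singleton fun w => ?_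
    obtain ⟨s, rfl⟩ := exists_frestrictLe_eq n w
    rw [Measure.map_apply (by fun_prop) (measurableSet_singleton _),
      Measure.map_apply (by fun_prop) (measurableSet_singleton _),
      frestrictLe_preimage_singleton, h]
  refine IsProjectiveLimit.unique (P := fun I => ν.map I.restrict) (fun I => ?_) (fun I => rfl)
  have hI : I ⊆ Finset.Iic (I.sup id) := I.subset_Iic_sup_id
  change μ.map I.restrict = ν.map I.restrict
  rw [← Finset.restrict₂_comp_restrict hI, ← Measure.map_map (by fun_prop) (by fun_prop),
    ← Measure.map_map (by fun_prop) (by fun_prop)]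
  exact congrArg _ (key _)

lemma measure_eq_zero_of_pathCylinder [Countable S] (μ : Measure (ℕ → S)) (n : ℕ)
    {A : Set (ℕ → S)} (h : ∀ s, μ (pathCylinder n s ∩ A) = 0) : μ A = 0 := by
  have : A ⊆ ⋃ w : (i : Finset.Iic n) → S, Preorder.frestrictLe n ⁻¹' {w} ∩ A :=
    fun ω hω => mem_iUnion.2 ⟨Preorder.frestrictLe n ω, rfl, hω⟩
  refine measure_mono_null this (measure_iUnion_null fun w => ?_)
  obtain ⟨s, rfl⟩ := exists_frestrictLe_eq n w
  rw [frestrictLe_preimage_singleton, h]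

namespace ShiftInvariant

variable {m : ℕ} {E F : Set (ℕ → S)}

protected lemma univ (m : ℕ) : ShiftInvariant m (univ : Set (ℕ → S)) :=
  ⟨.univ, fun _ => Iff.rfl⟩

protected lemma compl (hE : ShiftInvariant m E) : ShiftInvariant m Eᶜ :=
  ⟨hE.1.compl, fun ω => not_congr (hE.2 ω)⟩

protected lemma inter (hE : ShiftInvariant m E) (hF : ShiftInvariant m F) :
    ShiftInvariant m (E ∩ F) :=
  ⟨hE.1.inter hF.1, fun ω => and_congr (hE.2 ω) (hF.2 ω)⟩

protected lemma diff (hE : ShiftInvariant m E) (hF : ShiftInvariant m F) :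
    ShiftInvariant m (E \ F) := hE.inter hF.compl

protected lemma iUnion {ι : Type*} [Countable ι] {E : ι → Set (ℕ → S)}
    (hE : ∀ i, ShiftInvariant m (E i)) : ShiftInvariant m (⋃ i, E i) :=
  ⟨.iUnion fun i => (hE i).1, fun ω => by simp only [mem_iUnion, (hE _).2]⟩

protected lemma iInter {ι : Type*} [Countable ι] {E : ι → Set (ℕ → S)}
    (hE : ∀ i, ShiftInvariant m (E i)) : ShiftInvariant m (⋂ i, E i) :=
  ⟨.iInter fun i => (hE i).1, fun ω => by simp only [mem_iInter, (hE _).2]⟩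

protected lemma shift (hE : ShiftInvariant m E) (k : ℕ) :
    ShiftInvariant m (pathShiftBy k ⁻¹' E) :=
  ⟨measurable_pathShiftBy k hE.1, fun ω => by
    rw [mem_preimage, pathShiftBy_comm, hE.2, mem_preimage]⟩

lemma mul_left (hE : ShiftInvariant m E) (k : ℕ) : ShiftInvariant (k * m) E := by
  refine ⟨hE.1, fun ω => ?_⟩
  induction k with
  | zero => simp
  | succ k ih => rw [add_mul, one_mul, ← pathShiftBy_pathShiftBy, ← ih, pathShiftBy_comm, hE.2]

lemma of_one (hE : ShiftInvariant 1 E) (m : ℕ) : ShiftInvariant m E := by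
  simpa using hE.mul_left m

lemma preimage_eq (hE : ShiftInvariant m E) : pathShiftBy m ⁻¹' E = E :=
  Set.ext hE.2

/-- The first `m` shifts of an `m`-invariant event have a shift-invariant union. -/
lemma iUnion_shift (hE : ShiftInvariant m E) (hm : 0 < m) :
    ShiftInvariant 1 (⋃ j : Fin m, pathShiftBy j ⁻¹' E) := by
  refine ⟨.iUnion fun j => measurable_pathShiftBy _ hE.1, fun ω => ?_⟩
  simp only [mem_iUnion, mem_preimage, pathShiftBy_pathShiftBy]
  constructor
  · rintro ⟨j, hj⟩
    by_cases h : (j : ℕ) + 1 < m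
    · exact ⟨⟨j + 1, h⟩, hj⟩
    · refine ⟨⟨0, hm⟩, ?_⟩
      rw [show (j : ℕ) + 1 = m by omega, hE.2] at hj
      exact hj
  · rintro ⟨⟨j, hjm⟩, hj⟩
    rcases j with _ | j
    · refine ⟨⟨m - 1, by omega⟩, ?_⟩
      rw [show m - 1 + 1 = m by omega, hE.2]
      exact hj
    · exact ⟨⟨j, by omega⟩, hj⟩

end ShiftInvariant

end PathSpace

namespace MarkovChain

section MarkovProperty

variable {S : Type} [MeasurableSpace S] (X : MarkovChain S)

instance : IsProbabilityMeasure X.μ := X.μ_prob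

lemma measure_pathCylinder (n : ℕ) (s : ℕ → S) :
    X.μ (pathCylinder n s)
      = ENNReal.ofReal (X.init (s 0) * ∏ k ∈ Finset.range n, X.P (s k) (s (k + 1))) :=
  X.μ_cylinder n s

/-- The state `i` is visited at time `n` with positive probability. -/
def Reaches (n : ℕ) (i : S) : Prop := ∃ s : ℕ → S, s n = i ∧ X.μ (pathCylinder n s) ≠ 0

variable {X} in
lemma Reaches.step {n : ℕ} {i j : S} (h : X.Reaches n i) (hij : 0 < X.P i j) :
    X.Reaches (n + 1) j := by
  obtain ⟨s, rfl, hs⟩ := h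
  refine ⟨fun k => if k ≤ n then s k else j, by simp, ?_⟩
  rw [measure_pathCylinder, Ne, ENNReal.ofReal_eq_zero, not_le] at hs ⊢
  rw [Finset.prod_range_succ, ← mul_assoc]
  refine mul_pos ?_ (by simpa using hij)
  refine hs.trans_eq (congrArg (X.init (s 0) * ·) (Finset.prod_congr rfl fun k hk => ?_))
  have := Finset.mem_range.1 hk
  simp [this.le, Nat.succ_le_iff.2 this]

lemma Pn_nonneg (n : ℕ) (i j : S) : 0 ≤ X.Pn n i j := by
  induction n generalizing j with
  | zero => simp only [Pn]; split_ifs <;> norm_num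
  | succ n ih => exact tsum_nonneg fun k => mul_nonneg (ih k) (X.P_nonneg k j)

variable {X} in
lemma Reaches.add {n : ℕ} {i : S} (h : X.Reaches n i) (l : ℕ) {j : S} (hij : 0 < X.Pn l i j) :
    X.Reaches (n + l) j := by
  induction l generalizing j with
  | zero =>
    simp only [Pn] at hij
    split_ifs at hij with hh
    · exact hh ▸ h
    · exact absurd hij (lt_irrefl _)
  | succ l ih =>
    have : ∃ k, X.Pn l i k * X.P k j ≠ 0 := by
      by_contra! hc
      simp [Pn, hc] at hij
    obtain ⟨k, hk⟩ := this
    exact (ih ((X.Pn_nonneg l i k).lt_of_ne' (left_ne_zero_of_mul hk))).step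
      ((X.P_nonneg k j).lt_of_ne' (right_ne_zero_of_mul hk))

variable {X} in
/-- In an aperiodic chain, a reachable state is reachable at a multiple of any period. -/
lemma Reaches.exists_multiple (hap : X.Aperiodic) {n m : ℕ} (hm : 0 < m) {i : S}
    (h : X.Reaches n i) : ∃ k, X.Reaches (k * m) i := by
  let A : AddSubmonoid ℕ :=
    { carrier := {l | ∀ n, X.Reaches n i → X.Reaches (n + l) i}
      zero_mem' := fun n hn => hn
      add_mem' := fun {a b} ha hb n hn => by
        rw [← add_assoc]
        exact hb _ (ha _ hn) }
  have hgcd : Nat.setGcd {l | 0 < l ∧ 0 < X.Pn l i i} = 1 :=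
    hap i _ fun l hl hli => Nat.setGcd_dvd_of_mem ⟨hl, hli⟩
  obtain ⟨N, hN⟩ := Nat.exists_mem_closure_of_ge {l | 0 < l ∧ 0 < X.Pn l i i}
  have hA : ∀ l ≥ N, l ∈ A := fun l hl =>
    AddSubmonoid.closure_le (S := A).2 (fun a ha n hn => hn.add a ha.2)
      (hN l hl (by simp [hgcd]))
  have hle : n + N ≤ (n + N) * m := Nat.le_mul_of_pos_right _ hm
  refine ⟨n + N, ?_⟩
  have := hA ((n + N) * m - n) (by omega) n h
  rwa [Nat.add_sub_cancel' (by omega)] at this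

open Classical in
lemma measure_pathCylinder_inter_shift (n k : ℕ) (s t : ℕ → S) :
    X.μ (pathCylinder n s ∩ pathShiftBy n ⁻¹' pathCylinder k t) = X.μ (pathCylinder n s) *
      if t 0 = s n then ENNReal.ofReal (∏ j ∈ Finset.range k, X.P (t j) (t (j + 1))) else 0 := by
  split_ifs with h
  · rw [pathCylinder_inter_shift n k s t h, measure_pathCylinder, measure_pathCylinder,
      ← ENNReal.ofReal_mul (mul_nonneg (X.init_nonneg _)
        (Finset.prod_nonneg fun _ _ => X.P_nonneg _ _)),
      Finset.prod_range_add, mul_assoc]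
    have h0 : (if 0 < n then s 0 else t (0 - n)) = s 0 := by
      split_ifs with hn
      · rfl
      · obtain rfl : n = 0 := by omega
        exact h
    simp only [h0]
    congr 3
    · refine Finset.prod_congr rfl fun j hj => ?_
      have := Finset.mem_range.1 hj
      rw [if_pos this]
      split_ifs with hj'
      · rfl
      · obtain rfl : j + 1 = n := by omega
        simp [h]
    · refine Finset.prod_congr rfl fun j _ => ?_
      simp [add_assoc]
  · rw [mul_zero]
    convert measure_empty (μ := X.μ)
    refine Set.eq_empty_of_forall_notMem fun ω hω => h ?_
    have h1 : ω n = s n := hω.1 n le_rfl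
    have h2 : ω (0 + n) = t 0 := hω.2 0 (Nat.zero_le _)
    rw [← h1, ← h2, zero_add]

open Classical in
/-- The law of the chain started at `i` (zero if `i` is never visited), obtained by conditioning
on a path leading to `i`. -/
noncomputable def pathLaw (i : S) : Measure (ℕ → S) :=
  if h : ∃ w : ℕ × (ℕ → S), w.2 w.1 = i ∧ X.μ (pathCylinder w.1 w.2) ≠ 0 then
    (X.μ[|pathCylinder h.choose.1 h.choose.2]).map (pathShiftBy h.choose.1)
  else 0

lemma pathLaw_univ_le_one (i : S) : X.pathLaw i univ ≤ 1 := by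
  rw [pathLaw]
  split_ifs with h
  · rw [Measure.map_apply (by fun_prop) .univ]
    have := cond_isProbabilityMeasure (μ := X.μ) h.choose_spec.2
    exact prob_le_one
  · simp

instance (i : S) : IsFiniteMeasure (X.pathLaw i) :=
  ⟨(X.pathLaw_univ_le_one i).trans_lt ENNReal.one_lt_top⟩

variable [MeasurableSingletonClass S]

open Classical in
lemma map_cond_pathCylinder (n : ℕ) (s : ℕ → S) (hs : X.μ (pathCylinder n s) ≠ 0) (k : ℕ)
    (t : ℕ → S) :
    (X.μ[|pathCylinder n s]).map (pathShiftBy n) (pathCylinder k t) =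
      if t 0 = s n then ENNReal.ofReal (∏ j ∈ Finset.range k, X.P (t j) (t (j + 1))) else 0 := by
  rw [Measure.map_apply (by fun_prop) (measurableSet_pathCylinder _ _),
    cond_apply (measurableSet_pathCylinder _ _), measure_pathCylinder_inter_shift, ← mul_assoc,
    ENNReal.inv_mul_cancel hs (measure_ne_top _ _), one_mul]

variable [Countable S]

/-- The Markov property. -/
lemma measure_pathCylinder_inter (n : ℕ) (s : ℕ → S) {E : Set (ℕ → S)} (hE : MeasurableSet E) :
    X.μ (pathCylinder n s ∩ pathShiftBy n ⁻¹' E)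
      = X.μ (pathCylinder n s) * X.pathLaw (s n) E := by
  by_cases hs : X.μ (pathCylinder n s) = 0
  · rw [hs, zero_mul]
    exact measure_mono_null inter_subset_left hs
  have h : ∃ w : ℕ × (ℕ → S), w.2 w.1 = s n ∧ X.μ (pathCylinder w.1 w.2) ≠ 0 :=
    ⟨(n, s), rfl, hs⟩
  have : X.pathLaw (s n) = (X.μ[|pathCylinder n s]).map (pathShiftBy n) := by
    rw [pathLaw, dif_pos h]
    refine measure_ext_of_pathCylinder fun k t => ?_
    rw [map_cond_pathCylinder _ _ _ h.choose_spec.2, map_cond_pathCylinder _ _ _ hs,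
      h.choose_spec.1]
  rw [this, Measure.map_apply (by fun_prop) hE, cond_apply (measurableSet_pathCylinder _ _),
    ← mul_assoc, ENNReal.mul_inv_cancel hs (measure_ne_top _ _), one_mul]

variable {X} in
/-- Null invariant events stay null when shifted. -/
lemma measure_shift_eq_zero (hap : X.Aperiodic) {m : ℕ} (hm : 0 < m) {E : Set (ℕ → S)}
    (hE : ShiftInvariant m E) (h0 : X.μ E = 0) (k : ℕ) : X.μ (pathShiftBy k ⁻¹' E) = 0 := by
  refine measure_eq_zero_of_pathCylinder _ k fun s => ?_
  rw [X.measure_pathCylinder_inter k s hE.1]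
  by_cases hs : X.μ (pathCylinder k s) = 0
  · rw [hs, zero_mul]
  obtain ⟨l, t, ht, htl⟩ := Reaches.exists_multiple hap hm (⟨s, rfl, hs⟩ : X.Reaches k (s k))
  have := X.measure_pathCylinder_inter (l * m) t hE.1
  rw [(hE.mul_left l).preimage_eq, measure_mono_null inter_subset_right h0, ht] at this
  rw [(mul_eq_zero.1 this.symm).resolve_left htl, mul_zero]

variable {X} in
lemma measure_shift_eq_zero_iff (hap : X.Aperiodic) {m : ℕ} (hm : 0 < m) {E : Set (ℕ → S)}
    (hE : ShiftInvariant m E) (k : ℕ) : X.μ (pathShiftBy k ⁻¹' E) = 0 ↔ X.μ E = 0 := by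
  refine ⟨fun h => ?_, fun h => measure_shift_eq_zero hap hm hE h k⟩
  have := measure_shift_eq_zero hap hm (hE.shift k) h (k * (m - 1))
  have hk : k + k * (m - 1) = k * m := by
    obtain ⟨m, rfl⟩ := Nat.exists_eq_succ_of_ne_zero hm.ne'
    simp [Nat.mul_succ, add_comm]
  rwa [show pathShiftBy (k * (m - 1)) ⁻¹' (pathShiftBy k ⁻¹' E) = pathShiftBy (k * m) ⁻¹' E by
    ext ω; simp only [mem_preimage, pathShiftBy_pathShiftBy, hk],
    (hE.mul_left k).preimage_eq] at this

end MarkovProperty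

end MarkovChain

namespace MarkovChain

section Blackwell

variable {S : Type} [MeasurableSpace S] (X : MarkovChain S)

lemma L_subset_U (m : ℕ) (C : Set S) : X.L m C ⊆ X.U m C := fun _ ⟨n, hn⟩ k =>
  ⟨max n k, le_max_right _ _, hn _ (le_max_left _ _)⟩

/-- The states from which the event `E` has probability more than one half. -/
def likelyStates (E : Set (ℕ → S)) : Set S := {i | 1 / 2 < X.pathLaw i E}

lemma disjoint_likelyStates {E F : Set (ℕ → S)} (hF : MeasurableSet F) (h : Disjoint E F) :
    Disjoint (X.likelyStates E) (X.likelyStates F) := by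
  rw [Set.disjoint_left]
  intro i hi hi'
  have h1 : X.pathLaw i E + X.pathLaw i F ≤ 1 := by
    rw [← measure_union h hF]
    exact (measure_mono (subset_univ _)).trans (X.pathLaw_univ_le_one i)
  have h2 : (1 : ENNReal) < X.pathLaw i E + X.pathLaw i F := by
    rw [← ENNReal.add_halves 1]
    exact ENNReal.add_lt_add hi hi'
  exact absurd h1 (not_le.2 h2)

variable [MeasurableSingletonClass S] [Countable S]

lemma integrable_pathLaw (n : ℕ) (E : Set (ℕ → S)) :
    Integrable (fun ω => (X.pathLaw (ω n)).real E) X.μ := by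
  refine Integrable.of_bound (C := 1) ?_ (ae_of_all _ fun ω => ?_)
  · exact ((measurable_of_countable fun i => (X.pathLaw i).real E).comp
      (measurable_pi_apply n)).aestronglyMeasurable
  · rw [Real.norm_of_nonneg measureReal_nonneg]
    exact ENNReal.toReal_le_of_le_ofReal zero_le_one
      (((measure_mono (subset_univ _)).trans (X.pathLaw_univ_le_one _)).trans (by simp))

lemma setLIntegral_pathLaw (n : ℕ) {E : Set (ℕ → S)} (hE : MeasurableSet E)
    (hn : pathShiftBy n ⁻¹' E = E) {A : Set (ℕ → S)}
    (hA : MeasurableSet[MeasurableSpace.pi.comap (Preorder.frestrictLe n)] A) :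
    ∫⁻ ω in A, X.pathLaw (ω n) E ∂X.μ = X.μ (A ∩ E) := by
  have hmeas : Measurable fun ω : ℕ → S => X.pathLaw (ω n) E :=
    (measurable_of_countable fun i => X.pathLaw i E).comp (measurable_pi_apply n)
  obtain ⟨B, hB, rfl⟩ := hA
  have hr := Preorder.measurable_frestrictLe (X := fun _ : ℕ => S) n
  have key : (X.μ.withDensity fun ω => X.pathLaw (ω n) E).map (Preorder.frestrictLe n)
      = (X.μ.restrict E).map (Preorder.frestrictLe n) := by
    refine Measure.ext_of_singleton fun w => ?_
    obtain ⟨s, rfl⟩ := exists_frestrictLe_eq n w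
    have hc := measurableSet_pathCylinder n s
    rw [Measure.map_apply hr (measurableSet_singleton _),
      Measure.map_apply hr (measurableSet_singleton _), frestrictLe_preimage_singleton,
      withDensity_apply _ hc, Measure.restrict_apply hc]
    have h1 : X.μ (pathCylinder n s ∩ E) = X.μ (pathCylinder n s) * X.pathLaw (s n) E := by
      rw [← X.measure_pathCylinder_inter n s hE, hn]
    rw [h1, setLIntegral_congr_fun hc (g := fun _ => X.pathLaw (s n) E)
      (fun ω hω => by simp only [show ω n = s n from hω n le_rfl]), setLIntegral_const, mul_comm]
  have := congrArg (fun ν => ν B) key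
  simp only [Measure.map_apply hr hB] at this
  rwa [withDensity_apply _ (hr hB), Measure.restrict_apply (hr hB)] at this

lemma pathLaw_ae_eq_condExp (n : ℕ) {E : Set (ℕ → S)} (hE : MeasurableSet E)
    (hn : pathShiftBy n ⁻¹' E = E) :
    (fun ω => (X.pathLaw (ω n)).real E)
      =ᵐ[X.μ] X.μ[E.indicator (fun _ => (1 : ℝ)) | Filtration.piLE (X := fun _ : ℕ => S) n] := by
  have hle := (Filtration.piLE (X := fun _ : ℕ => S)).le n
  refine ae_eq_condExp_of_forall_setIntegral_eq hle
    ((integrable_const (1 : ℝ)).indicator hE)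
    (fun A _ _ => (X.integrable_pathLaw n E).integrableOn) (fun A hA _ => ?_) ?_
  · have hA' := hle A hA
    rw [Filtration.piLE_eq_comap_frestrictLe] at hA
    rw [setIntegral_indicator hE, setIntegral_const, smul_eq_mul, mul_one, Measure.real,
      ← X.setLIntegral_pathLaw n hE hn hA]
    refine integral_toReal ?_ (ae_of_all _ fun ω => measure_lt_top _ _)
    exact ((measurable_of_countable fun i => X.pathLaw i E).comp
      (measurable_pi_apply n)).aemeasurable
  · refine Measurable.aestronglyMeasurable ?_
    rw [Filtration.piLE_eq_comap_frestrictLe]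
    exact (measurable_of_countable fun w : ((i : Finset.Iic n) → S) =>
      (X.pathLaw (w ⟨n, by simp⟩)).real E).comp (comap_measurable _)

/-- Lévy's zero-one law for invariant events. -/
lemma tendsto_pathLaw {m : ℕ} (hm : 0 < m) {E : Set (ℕ → S)} (hE : ShiftInvariant m E) :
    ∀ᵐ ω ∂X.μ, Tendsto (fun k => (X.pathLaw (ω (k * m))).real E) atTop
      (nhds (E.indicator (fun _ => (1 : ℝ)) ω)) := by
  let ℱ := Filtration.piLE (X := fun _ : ℕ => S)
  have hsup : ⨆ n, ℱ n = MeasurableSpace.pi := by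
    refine le_antisymm (iSup_le fun n => ℱ.le n) (iSup_le fun n => ?_)
    refine le_trans ?_ (le_iSup _ n)
    rw [Filtration.piLE_eq_comap_frestrictLe]
    exact Measurable.comap_le ((measurable_pi_apply (⟨n, by simp⟩ : Finset.Iic n)).comp
      (comap_measurable (Preorder.frestrictLe (π := fun _ : ℕ => S) n)))
  have h1 := Integrable.tendsto_ae_condExp (μ := X.μ) (ℱ := ℱ)
    ((integrable_const (1 : ℝ)).indicator hE.1)
    (by rw [hsup]; exact stronglyMeasurable_const.indicator hE.1)
  have h2 : ∀ᵐ ω ∂X.μ, ∀ k : ℕ, (X.pathLaw (ω (k * m))).real E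
      = (X.μ[E.indicator (fun _ => (1 : ℝ)) | ℱ (k * m)]) ω :=
    ae_all_iff.2 fun k => X.pathLaw_ae_eq_condExp (k * m) hE.1 (hE.mul_left k).preimage_eq
  filter_upwards [h1, h2] with ω h1 h2
  simp only [h2]
  exact h1.comp (tendsto_id.atTop_mul_const' hm)

lemma likelyStates_spec {m : ℕ} (hm : 0 < m) {E : Set (ℕ → S)} (hE : ShiftInvariant m E) :
    ∀ᵐ ω ∂X.μ, (ω ∈ X.L m (X.likelyStates E) ↔ ω ∈ E) ∧
      (ω ∈ X.U m (X.likelyStates E) ↔ ω ∈ E) := by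
  have hmem : ∀ i, i ∈ X.likelyStates E ↔ (1 / 2 : ℝ) < (X.pathLaw i).real E := fun i => by
    rw [Measure.real, ← ENNReal.ofReal_lt_iff_lt_toReal (by norm_num) (measure_ne_top _ _)]
    simp [likelyStates]
  filter_upwards [X.tendsto_pathLaw hm hE] with ω hω
  by_cases h : ω ∈ E
  · rw [indicator_of_mem h] at hω
    obtain ⟨n, hn⟩ := eventually_atTop.1
      (hω.eventually (lt_mem_nhds (show (1 / 2 : ℝ) < 1 by norm_num)))
    have hL : ω ∈ X.L m (X.likelyStates E) := ⟨n, fun k hk => (hmem _).2 (hn k hk)⟩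
    simp [h, hL, X.L_subset_U m _ hL]
  · rw [indicator_of_notMem h] at hω
    obtain ⟨n, hn⟩ := eventually_atTop.1
      (hω.eventually (gt_mem_nhds (show (0 : ℝ) < 1 / 2 by norm_num)))
    have hU : ω ∉ X.U m (X.likelyStates E) := fun hU => by
      obtain ⟨k, hk, hk'⟩ := hU n
      exact lt_asymm ((hmem _).1 hk') (hn k hk)
    exact ⟨iff_of_false (fun hL => hU (X.L_subset_U m _ hL)) h, iff_of_false hU h⟩

end Blackwell

end MarkovChain

namespace MarkovChain

section AlmostClosedSets

variable {S : Type} [MeasurableSpace S] {X : MarkovChain S} {m : ℕ}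

/-- Up to null events, both `L^(m)(C)` and `U^(m)(C)` are equal to `E`. -/
def Represents (X : MarkovChain S) (m : ℕ) (C : Set S) (E : Set (ℕ → S)) : Prop :=
  ∀ᵐ ω ∂X.μ, (ω ∈ X.L m C ↔ ω ∈ E) ∧ (ω ∈ X.U m C ↔ ω ∈ E)

/-- Every `m`-invariant event contains almost all or almost nothing of `E`. -/
def Indivisible (X : MarkovChain S) (m : ℕ) (E : Set (ℕ → S)) : Prop :=
  ∀ F, ShiftInvariant m F → X.μ (E ∩ F) = 0 ∨ X.μ (E \ F) = 0

lemma Indivisible.congr {E F : Set (ℕ → S)} (hE : X.Indivisible m E)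
    (h : E =ᵐ[X.μ] F) : X.Indivisible m F := fun G hG =>
  (hE G hG).imp (fun h0 => (measure_congr (h.inter (ae_eq_refl G))) ▸ h0)
    (fun h0 => (measure_congr (h.diff (ae_eq_refl G))) ▸ h0)

lemma regular_iff {C : Set S} : X.Regular m C ↔ X.Represents m C (X.L m C) := by
  rw [Regular, measure_symmDiff_eq_zero_iff, eventuallyEq_set]
  exact eventually_congr (ae_of_all _ fun ω => by simp)

namespace Represents

variable {C D : Set S} {E F : Set (ℕ → S)}

lemma L_ae_eq (h : X.Represents m C E) : X.L m C =ᵐ[X.μ] E :=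
  eventuallyEq_set.2 (h.mono fun _ hω => hω.1)

lemma U_ae_eq (h : X.Represents m C E) : X.U m C =ᵐ[X.μ] E :=
  eventuallyEq_set.2 (h.mono fun _ hω => hω.2)

lemma almostClosed (h : X.Represents m C E) (hE : X.μ E ≠ 0) : X.AlmostClosed m C := by
  refine ⟨regular_iff.2 (h.mono fun ω hω => ⟨Iff.rfl, hω.2.trans hω.1.symm⟩), fun hT => hE ?_⟩
  rwa [← measure_congr h.U_ae_eq]

lemma inter (hC : X.Represents m C E) (hD : X.Represents m D F) :
    X.Represents m (C ∩ D) (E ∩ F) := by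
  filter_upwards [hC, hD] with ω h1 h2
  have hL : ω ∈ X.L m (C ∩ D) ↔ ω ∈ E ∩ F := by
    rw [mem_inter_iff, ← h1.1, ← h2.1]
    constructor
    · rintro ⟨n, hn⟩
      exact ⟨⟨n, fun k hk => (hn k hk).1⟩, ⟨n, fun k hk => (hn k hk).2⟩⟩
    · rintro ⟨⟨n, hn⟩, ⟨l, hl⟩⟩
      exact ⟨max n l, fun k hk => ⟨hn k ((le_max_left _ _).trans hk),
        hl k ((le_max_right _ _).trans hk)⟩⟩
  refine ⟨hL, fun h => ?_, fun h => X.L_subset_U m _ (hL.2 h)⟩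
  refine ⟨h1.2.1 fun n => ?_, h2.2.1 fun n => ?_⟩
  · obtain ⟨k, hk, hk'⟩ := h n
    exact ⟨k, hk, hk'.1⟩
  · obtain ⟨k, hk, hk'⟩ := h n
    exact ⟨k, hk, hk'.2⟩

end Represents

lemma AlmostClosed.represents {C : Set S} (h : X.AlmostClosed m C) :
    X.Represents m C (X.L m C) := regular_iff.1 h.1

lemma AlmostClosed.measure_L_ne_zero {C : Set S} (h : X.AlmostClosed m C) :
    X.μ (X.L m C) ≠ 0 := by
  rw [← measure_congr h.represents.U_ae_eq]
  exact h.2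

lemma disjoint_L {C D : Set S} (h : Disjoint C D) : Disjoint (X.L m C) (X.L m D) := by
  rw [Set.disjoint_left]
  rintro ω ⟨n, hn⟩ ⟨k, hk⟩
  exact Set.disjoint_left.1 h (hn (max n k) (le_max_left _ _)) (hk (max n k) (le_max_right _ _))

lemma L_mono {C D : Set S} (h : C ⊆ D) : X.L m C ⊆ X.L m D :=
  fun _ ⟨n, hn⟩ => ⟨n, fun k hk => h (hn k hk)⟩

variable [MeasurableSingletonClass S] [Countable S]

lemma shiftInvariant_L (X : MarkovChain S) (m : ℕ) (C : Set S) : ShiftInvariant m (X.L m C) := by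
  constructor
  · have : X.L m C = ⋃ n, ⋂ k, ⋂ (_ : n ≤ k), (fun ω : ℕ → S => ω (k * m)) ⁻¹' C := by
      ext ω
      simp [L]
    rw [this]
    exact .iUnion fun n => .iInter fun k => .iInter fun _ =>
      measurable_pi_apply _ C.to_countable.measurableSet
  · intro ω
    have hs : ∀ k, pathShiftBy m ω (k * m) = ω ((k + 1) * m) := fun k => by
      rw [pathShiftBy, add_mul, one_mul]
    constructor
    · rintro ⟨n, hn⟩
      refine ⟨n + 1, fun k hk => ?_⟩
      have := hn (k - 1) (by omega)
      rwa [hs, Nat.sub_add_cancel (by omega)] at this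
    · rintro ⟨n, hn⟩
      exact ⟨n, fun k hk => (hs k).symm ▸ hn (k + 1) (by omega)⟩

lemma represents_likelyStates (hm : 0 < m) {E : Set (ℕ → S)} (hE : ShiftInvariant m E) :
    X.Represents m (X.likelyStates E) E := X.likelyStates_spec hm hE

lemma Atomic.indivisible {C : Set S} (hm : 0 < m) (h : X.Atomic m C) :
    X.Indivisible m (X.L m C) := by
  intro F hF
  by_contra! hc
  exact h.2 ⟨C ∩ X.likelyStates F, C ∩ X.likelyStates Fᶜ, inter_subset_left, inter_subset_left,
    (X.disjoint_likelyStates hF.compl.1 disjoint_compl_right).mono inter_subset_right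
      inter_subset_right,
    (h.1.represents.inter (represents_likelyStates hm hF)).almostClosed hc.1,
    (h.1.represents.inter (represents_likelyStates hm hF.compl)).almostClosed hc.2⟩

lemma Indivisible.atomic {C : Set S} (h : X.Indivisible m (X.L m C)) (hC : X.AlmostClosed m C) :
    X.Atomic m C := by
  refine ⟨hC, ?_⟩
  rintro ⟨A, B, hAC, hBC, hAB, hA, hB⟩
  rcases h _ (X.shiftInvariant_L m A) with h0 | h0
  · rw [inter_eq_self_of_subset_right (L_mono hAC)] at h0
    exact hA.measure_L_ne_zero h0
  · exact hB.measure_L_ne_zero (measure_mono_null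
      (subset_sdiff.2 ⟨L_mono hBC, (disjoint_L hAB).symm⟩) h0)

lemma Represents.atomic {C : Set S} {E : Set (ℕ → S)} (h : X.Represents m C E)
    (hE : X.μ E ≠ 0) (hE' : X.Indivisible m E) : X.Atomic m C :=
  (hE'.congr h.L_ae_eq.symm).atomic (h.almostClosed hE)

end AlmostClosedSets

section InvariantEvents

variable {S : Type} [MeasurableSpace S] {X : MarkovChain S} {m : ℕ}

/-- A family of pairwise disjoint, non-null, `m`-invariant events. -/
structure IsInvariantFamily (X : MarkovChain S) (m : ℕ) {ι : Type*} (F : ι → Set (ℕ → S)) :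
    Prop where
  invariant : ∀ i, ShiftInvariant m (F i)
  ne_zero : ∀ i, X.μ (F i) ≠ 0
  disjoint : ∀ i j, i ≠ j → Disjoint (F i) (F j)

/-- The `m`-invariant events split into `n` indivisible ones. -/
structure IsInvariantPartition (X : MarkovChain S) (m n : ℕ) (F : Fin n → Set (ℕ → S)) : Prop
    extends X.IsInvariantFamily m F where
  indivisible : ∀ i, X.Indivisible m (F i)
  cover : X.μ (⋃ i, F i)ᶜ = 0

lemma IsInvariantFamily.isInvariantPartition {n : ℕ} {F : Fin n → Set (ℕ → S)}
    (hF : X.IsInvariantFamily m F)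
    (hmax : ¬ ∃ G : Fin (n + 1) → Set (ℕ → S), X.IsInvariantFamily m G) :
    X.IsInvariantPartition m n F := by
  have key : ∀ B, ShiftInvariant m B → X.μ B ≠ 0 → ∃ j, X.μ (F j \ B) = 0 := by
    intro B hB hB0
    by_contra! hc
    refine hmax ⟨Fin.cons B fun j => F j \ B, ⟨?_, ?_, ?_⟩⟩
    · exact Fin.cases hB fun j => (hF.invariant j).diff hB
    · exact Fin.cases hB0 hc
    · refine Fin.cases (Fin.cases (fun h => absurd rfl h) fun j _ => disjoint_sdiff_right) fun i =>
        Fin.cases (fun _ => disjoint_sdiff_left) fun j hij => ?_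
      exact (hF.disjoint i j fun h => hij (congrArg _ h)).mono sdiff_subset sdiff_subset
  refine ⟨hF, fun i B hB => ?_, ?_⟩
  · by_contra! hc
    obtain ⟨j, hj⟩ := key _ ((hF.invariant i).inter hB) hc.1
    rcases eq_or_ne j i with rfl | hji
    · exact hc.2 (by rwa [sdiff_self_inter] at hj)
    · rw [((hF.disjoint j i hji).mono_right inter_subset_left).sdiff_eq_left] at hj
      exact hF.ne_zero j hj
  · by_contra hc
    obtain ⟨j, hj⟩ := key _ (ShiftInvariant.iUnion hF.invariant).compl hc
    rw [sdiff_compl, inter_eq_self_of_subset_left (subset_iUnion F j)] at hj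
    exact hF.ne_zero j hj

lemma card_le_of_isInvariantFamily (htriv : ∀ E, ShiftInvariant 1 E → X.μ E = 0 ∨ X.μ Eᶜ = 0)
    (hm : 0 < m) {n : ℕ} {F : Fin n → Set (ℕ → S)} (hF : X.IsInvariantFamily m F) : n ≤ m := by
  have h : ∀ i, ∀ᵐ ω ∂X.μ, ω ∈ ⋃ j : Fin m, pathShiftBy j ⁻¹' F i := fun i => by
    refine (htriv _ ((hF.invariant i).iUnion_shift hm)).resolve_left fun h0 => hF.ne_zero i ?_
    exact measure_mono_null (fun ω hω => mem_iUnion.2 ⟨⟨0, hm⟩, hω⟩) h0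
  obtain ⟨ω, hω⟩ := (ae_all_iff.2 h).exists
  simp only [mem_iUnion] at hω
  choose f hf using hω
  have hinj : Function.Injective f := fun i j hij => by
    by_contra hne
    exact Set.disjoint_left.1 (hF.disjoint i j hne) (hf i) (hij ▸ hf j)
  simpa using Fintype.card_le_of_injective f hinj

lemma exists_isInvariantPartition
    (htriv : ∀ E, ShiftInvariant 1 E → X.μ E = 0 ∨ X.μ Eᶜ = 0) (hm : 0 < m) :
    ∃ n F, X.IsInvariantPartition m n F := by
  by_contra! hc
  have : ∀ n, ∃ F : Fin n → Set (ℕ → S), X.IsInvariantFamily m F := by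
    intro n
    induction n with
    | zero => exact ⟨Fin.elim0, ⟨fun i => i.elim0, fun i => i.elim0, fun i => i.elim0⟩⟩
    | succ n ih =>
      obtain ⟨F, hF⟩ := ih
      by_contra hmax
      exact hc n F (hF.isInvariantPartition hmax)
  obtain ⟨F, hF⟩ := this (m + 1)
  exact absurd (card_le_of_isInvariantFamily htriv hm hF) (by omega)

variable [MeasurableSingletonClass S] [Countable S]

lemma exists_cyclic_family (htriv : ∀ E, ShiftInvariant 1 E → X.μ E = 0 ∨ X.μ Eᶜ = 0)
    (hap : X.Aperiodic) (hm : 0 < m) {n : ℕ} {F : Fin n → Set (ℕ → S)}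
    (hF : X.IsInvariantPartition m n F) :
    ∃ c, 0 < c ∧ n ≤ c ∧ ∃ G : Fin c → Set (ℕ → S), X.IsInvariantFamily c G := by
  rcases Nat.eq_zero_or_pos n with rfl | hn
  · exact ⟨1, one_pos, zero_le_one, fun _ => univ, fun _ => .univ 1, fun _ => by simp,
      fun i j hij => absurd (Subsingleton.elim i j) hij⟩
  obtain ⟨E, hE, hE0, hEi⟩ : ∃ E, ShiftInvariant m E ∧ X.μ E ≠ 0 ∧ X.Indivisible m E :=
    ⟨F ⟨0, hn⟩, hF.invariant _, hF.ne_zero _, hF.indivisible _⟩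
  obtain ⟨c, ⟨hc, hcE⟩, hcmin⟩ : ∃ c, (0 < c ∧ X.μ (E ∩ pathShiftBy c ⁻¹' E) ≠ 0) ∧
      ∀ i, 0 < i → i < c → X.μ (E ∩ pathShiftBy i ⁻¹' E) = 0 := by
    classical
    have hex : ∃ c, 0 < c ∧ X.μ (E ∩ pathShiftBy c ⁻¹' E) ≠ 0 :=
      ⟨m, hm, by rwa [hE.preimage_eq, inter_self]⟩
    refine ⟨Nat.find hex, Nat.find_spec hex, fun i hi hic => ?_⟩
    by_contra h
    exact Nat.find_min hex hic ⟨hi, h⟩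
  have hE1 : X.μ (E \ pathShiftBy c ⁻¹' E) = 0 := (hEi _ (hE.shift c)).resolve_left hcE
  have hEj : ∀ j : ℕ, X.μ (E \ pathShiftBy (j * c) ⁻¹' E) = 0 := by
    intro j
    induction j with
    | zero => simp [show pathShiftBy (S := S) 0 = id from rfl]
    | succ j ih =>
      refine measure_mono_null (fun ω hω => ?_) (measure_union_null ih
        (measure_shift_eq_zero hap hm (hE.diff (hE.shift c)) hE1 (j * c)))
      by_cases h : pathShiftBy (j * c) ω ∈ E
      · refine Or.inr ⟨h, fun h' => hω.2 ?_⟩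
        rwa [mem_preimage, pathShiftBy_pathShiftBy, add_comm, ← Nat.succ_mul] at h'
      · exact Or.inl ⟨hω.1, h⟩
  -- the part of `E` that is exactly invariant under the `c`-fold shift
  let G := ⋂ j : ℕ, pathShiftBy (j * c) ⁻¹' E
  have hGm : ShiftInvariant m G := .iInter fun j => hE.shift _
  have hGc : ShiftInvariant c G := by
    refine ⟨hGm.1, fun ω => ?_⟩
    simp only [G, mem_iInter, mem_preimage, pathShiftBy_pathShiftBy]
    refine ⟨fun h j => ?_, fun h j => ?_⟩
    · rcases j with _ | j
      · have := h (m - 1)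
        rw [← Nat.succ_mul, Nat.succ_eq_add_one, Nat.sub_add_cancel hm, mul_comm,
          (hE.mul_left c).2] at this
        simpa using this
      · rw [Nat.succ_mul]
        exact h j
    · rw [← Nat.succ_mul]
      exact h (j + 1)
  have hGE : G ⊆ E := fun ω hω => by simpa using mem_iInter.1 hω 0
  have hEG : X.μ (E \ G) = 0 := by
    rw [sdiff_iInter]
    exact measure_iUnion_null hEj
  let H := G \ ⋃ i : Fin (c - 1), pathShiftBy (i + 1) ⁻¹' G
  have hHm : ShiftInvariant m H := hGm.diff (.iUnion fun i => hGm.shift _)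
  have hHc : ShiftInvariant c H := hGc.diff (.iUnion fun i => hGc.shift _)
  have hHE : H ⊆ E := sdiff_subset.trans hGE
  have hEH : X.μ (E \ H) = 0 := by
    refine measure_mono_null (fun ω hω => ?_) (measure_union_null hEG
      (measure_iUnion_null fun i : Fin (c - 1) => hcmin (i + 1) (by omega) (by omega)))
    by_cases h : ω ∈ G
    · right
      have : ω ∈ ⋃ i : Fin (c - 1), pathShiftBy (i + 1) ⁻¹' G := by
        by_contra h'
        exact hω.2 ⟨h, h'⟩
      obtain ⟨i, hi⟩ := mem_iUnion.1 this
      exact mem_iUnion.2 ⟨i, hω.1, hGE hi⟩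
    · exact Or.inl ⟨hω.1, h⟩
  have hH0 : X.μ H ≠ 0 := fun h0 => hE0 <| measure_mono_null
    (fun ω hω => (em (ω ∈ H)).imp id fun h => ⟨hω, h⟩) (measure_union_null h0 hEH)
  have hHdisj : ∀ i, 0 < i → i < c → ∀ ω ∈ H, pathShiftBy i ω ∉ H := by
    intro i hi hic ω hω hω'
    refine hω.2 (mem_iUnion.2 ⟨⟨i - 1, by omega⟩, ?_⟩)
    simpa [Nat.sub_add_cancel hi] using hω'.1
  have hlt : ∀ i j : Fin c, i < j →
      Disjoint (pathShiftBy i ⁻¹' H) (pathShiftBy j ⁻¹' H) := by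
    intro i j hij
    refine Set.disjoint_left.2 fun ω hi hj => ?_
    have hij' : (i : ℕ) < j := hij
    refine hHdisj (j - i) (by omega) (by omega) _ hi ?_
    rwa [pathShiftBy_pathShiftBy, Nat.sub_add_cancel hij'.le]
  refine ⟨c, hc, ?_, fun j => pathShiftBy j ⁻¹' H, fun j => hHc.shift j,
    fun j => (measure_shift_eq_zero_iff hap hm hHm j).not.2 hH0, fun i j hij =>
      hij.lt_or_gt.elim (hlt i j) fun h => (hlt j i h).symm⟩
  have hcover : X.μ (⋃ j : Fin c, pathShiftBy j ⁻¹' H)ᶜ = 0 := by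
    refine (htriv _ (hHc.iUnion_shift hc)).resolve_left fun h0 => hH0 ?_
    exact measure_mono_null (fun ω hω => mem_iUnion.2 ⟨⟨0, hc⟩, hω⟩) h0
  have hmeet : ∀ k, ∃ i : Fin c, X.μ (F k ∩ pathShiftBy i ⁻¹' H) ≠ 0 := by
    intro k
    by_contra! h
    refine hF.ne_zero k (measure_mono_null (fun ω hω => ?_)
      (measure_union_null hcover (measure_iUnion_null h)))
    by_cases h' : ω ∈ ⋃ j : Fin c, pathShiftBy j ⁻¹' H
    · obtain ⟨j, hj⟩ := mem_iUnion.1 h'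
      exact Or.inr (mem_iUnion.2 ⟨j, hω, hj⟩)
    · exact Or.inl h'
  choose f hf using hmeet
  have hinj : Function.Injective f := by
    intro k l hkl
    by_contra hne
    have hback : ∀ k' (i : ℕ), X.μ (F k' ∩ pathShiftBy i ⁻¹' H) ≠ 0 →
        X.μ (E ∩ pathShiftBy (i * (m - 1)) ⁻¹' F k') ≠ 0 := by
      intro k' i h h0
      refine h ((measure_shift_eq_zero_iff hap hm ((hF.invariant k').inter (hHm.shift i))
        (i * (m - 1))).1 (measure_mono_null ?_ h0))
      refine fun ω hω => ⟨hHE ?_, hω.1⟩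
      have := hω.2
      rw [mem_preimage, pathShiftBy_pathShiftBy] at this
      obtain ⟨m, rfl⟩ := Nat.exists_eq_succ_of_ne_zero hm.ne'
      rw [Nat.succ_sub_one, add_comm, ← Nat.mul_succ, (hHm.mul_left i).2] at this
      exact this
    have hk := hback k (f k) (hf k)
    have hl := hback l (f k) (hkl ▸ hf l)
    refine hl (measure_mono_null ?_ ((hEi _ ((hF.invariant k).shift _)).resolve_left hk))
    refine fun ω hω => ⟨hω.1, fun hω' => ?_⟩
    exact Set.disjoint_left.1 (hF.disjoint k l hne) hω' hω.2
  simpa using Fintype.card_le_of_injective f hinj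

end InvariantEvents

end MarkovChain

namespace MarkovChain

section Beta

variable {S : Type} [MeasurableSpace S] {X : MarkovChain S} {m n : ℕ}

lemma Represents.of_one {C : Set S} (h : X.Represents 1 C univ) (hm : 0 < m) :
    X.Represents m C univ := by
  filter_upwards [h] with ω hω
  have hL : ω ∈ X.L m C := by
    obtain ⟨n, hn⟩ := hω.1.2 (mem_univ ω)
    refine ⟨n, fun k hk => ?_⟩
    simpa using hn (k * m) (hk.trans (Nat.le_mul_of_pos_right k hm))
  exact ⟨iff_of_true hL (mem_univ ω), iff_of_true (X.L_subset_U m C hL) (mem_univ ω)⟩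

lemma Simple.exists_isBlackwell (h : X.Simple) : ∃ C, X.IsBlackwell 1 {C} := by
  have hne : (Set.encard '' {𝒞 : Set (Set S) | X.IsBlackwell 1 𝒞}).Nonempty := by
    by_contra hc
    rw [not_nonempty_iff_eq_empty] at hc
    rw [Simple, beta, hc, sInf_empty] at h
    exact absurd h (by simp)
  obtain ⟨𝒞, h𝒞, hcard⟩ := csInf_mem hne
  obtain ⟨C, rfl⟩ := encard_eq_one.1 (hcard.trans h)
  exact ⟨C, h𝒞⟩

lemma le_period (hm : 1 ≤ m) (h : X.beta m = m) : (m : ℕ∞) ≤ X.period :=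
  le_sSup ⟨m, hm, h, rfl⟩

variable [MeasurableSingletonClass S] [Countable S]

lemma IsBlackwell.measure_iUnion_L {𝒞 : Set (Set S)} (h : X.IsBlackwell m 𝒞) :
    X.μ (⋃ C ∈ 𝒞, X.L m C) = 1 := by
  rw [measure_biUnion (f := fun C => X.L m C) h.countable
    (fun C hC D hD hCD => disjoint_L (h.disjoint hC hD hCD))
    (fun C _ => (X.shiftInvariant_L m C).1), h.sum_L_eq_one]

lemma IsInvariantPartition.isBlackwell (hm : 0 < m) {F : Fin n → Set (ℕ → S)}
    (hF : X.IsInvariantPartition m n F) :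
    X.IsBlackwell m (range fun i => X.likelyStates (F i)) := by
  have hrep : ∀ i, X.Represents m (X.likelyStates (F i)) (F i) := fun i =>
    represents_likelyStates hm (hF.invariant i)
  have hat : ∀ C ∈ range fun i => X.likelyStates (F i), X.Atomic m C := by
    rintro _ ⟨i, rfl⟩
    exact (hrep i).atomic (hF.ne_zero i) (hF.indivisible i)
  have hdisj : (range fun i => X.likelyStates (F i)).PairwiseDisjoint id := by
    rintro _ ⟨i, rfl⟩ _ ⟨j, rfl⟩ hij
    exact X.disjoint_likelyStates (hF.invariant j).1
      (hF.disjoint i j fun h => hij (by simp only [h]))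
  have hcount := countable_range fun i => X.likelyStates (F i)
  refine ⟨hcount, fun C hC => (hat C hC).1, hdisj, fun C hC _ _ h => absurd (hat C hC) h,
    fun C hC h => absurd (hat C hC) h, fun C hC h => absurd (hat C hC) h, ?_⟩
  rw [← measure_biUnion (f := fun C => X.L m C) hcount
    (fun C hC D hD hCD => disjoint_L (hdisj hC hD hCD))
    (fun C _ => (X.shiftInvariant_L m C).1), biUnion_range]
  have : (⋃ i, X.L m (X.likelyStates (F i))) =ᵐ[X.μ] ⋃ i, F i :=
    Filter.EventuallyEq.countable_iUnion fun i => (hrep i).L_ae_eq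
  rw [measure_congr this]
  exact (prob_compl_eq_zero_iff (MeasurableSet.iUnion fun i => (hF.invariant i).1)).1 hF.cover

lemma IsInvariantPartition.beta_le (hm : 0 < m) {F : Fin n → Set (ℕ → S)}
    (hF : X.IsInvariantPartition m n F) : X.beta m ≤ n := by
  refine (sInf_le (mem_image_of_mem _ (hF.isBlackwell hm))).trans ?_
  rw [← image_univ]
  exact (encard_image_le _ _).trans (by simp)

lemma IsInvariantPartition.le_beta (hm : 0 < m) {F : Fin n → Set (ℕ → S)}
    (hF : X.IsInvariantPartition m n F) : n ≤ X.beta m := by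
  refine le_sInf ?_
  rintro _ ⟨𝒞, h𝒞, rfl⟩
  have hcover : X.μ (⋃ C ∈ 𝒞, X.L m C)ᶜ = 0 :=
    (prob_compl_eq_zero_iff (.biUnion h𝒞.countable fun C _ => (X.shiftInvariant_L m C).1)).2
      h𝒞.measure_iUnion_L
  have hmeet : ∀ i, ∃ C : 𝒞, X.μ (X.L m C ∩ F i) ≠ 0 := by
    intro i
    by_contra! hc
    have := h𝒞.countable.to_subtype
    refine hF.ne_zero i (measure_mono_null (fun ω hω => ?_)
      (measure_union_null hcover (measure_iUnion_null hc)))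
    by_cases h : ω ∈ ⋃ C ∈ 𝒞, X.L m C
    · obtain ⟨C, hC, hω'⟩ := mem_iUnion₂.1 h
      exact Or.inr (mem_iUnion.2 ⟨⟨C, hC⟩, hω', hω⟩)
    · exact Or.inl h
  choose f hf using hmeet
  have hinj : Function.Injective f := by
    intro i j hij
    by_contra hne
    by_cases hat : X.Atomic m (f i : Set S)
    · refine hf j (measure_mono_null ?_
        ((hat.indivisible hm _ (hF.invariant i)).resolve_left (hf i)))
      refine fun ω hω => ⟨hij ▸ hω.1, fun hω' => ?_⟩
      exact Set.disjoint_left.1 (hF.disjoint i j hne) hω' hω.2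
    · refine h𝒞.nonatomicNoAtomicSubset _ (f i).2 hat (f i ∩ X.likelyStates (F i))
        inter_subset_left (Represents.atomic (E := X.L m (f i) ∩ F i) ?_ (hf i) ?_)
      · exact (h𝒞.almostClosed _ (f i).2).represents.inter
          (represents_likelyStates hm (hF.invariant i))
      · exact fun B hB => (hF.indivisible i B hB).imp
          (measure_mono_null (inter_subset_inter_left _ inter_subset_right))
          (measure_mono_null (sdiff_subset_sdiff_left inter_subset_right))
  have := ENat.card_le_card_of_injective hinj
  rwa [ENat.card_eq_coe_fintype_card, Fintype.card_fin] at this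

/-- The union of the shifts of an indivisible `m`-invariant event is indivisible. -/
lemma Indivisible.iUnion_shift (hap : X.Aperiodic) (hm : 0 < m) {E : Set (ℕ → S)}
    (hE : ShiftInvariant m E) (h : X.Indivisible m E) :
    X.Indivisible 1 (⋃ j : Fin m, pathShiftBy j ⁻¹' E) := by
  have key : ∀ F, ShiftInvariant 1 F → X.μ (E ∩ F) = 0 →
      X.μ ((⋃ j : Fin m, pathShiftBy j ⁻¹' E) ∩ F) = 0 := by
    intro F hF h0
    rw [iUnion_inter]
    refine measure_iUnion_null fun j => ?_
    have := measure_shift_eq_zero hap hm (hE.inter (hF.of_one m)) h0 j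
    rwa [preimage_inter, (hF.of_one j).preimage_eq] at this
  exact fun F hF => (h F (hF.of_one m)).imp (key F hF) (key Fᶜ hF.compl)

/-- Without atomic sets, one set suffices for all `m`-step chains. -/
lemma isBlackwell_singleton_of_not_atomic (hap : X.Aperiodic) (hm : 0 < m) {C : Set S}
    (hC : X.IsBlackwell 1 {C}) (hrep : X.Represents 1 C univ) (hat : ¬ X.Atomic 1 C) :
    X.IsBlackwell m {C} := by
  have hCm := hrep.of_one hm
  refine ⟨countable_singleton C, ?_, pairwiseDisjoint_singleton _ _, ?_, ?_, ?_, ?_⟩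
  · rintro _ rfl
    exact hCm.almostClosed (by simp)
  · rintro _ rfl _ rfl _ _
    rfl
  · rintro _ rfl - A - hA
    have hE := X.shiftInvariant_L m A
    have hU := hE.iUnion_shift hm
    refine hC.nonatomicNoAtomicSubset _ rfl hat _ inter_subset_left
      ((hrep.inter (represents_likelyStates one_pos hU)).atomic ?_ ?_) <;> rw [univ_inter]
    · exact fun h0 => hA.1.measure_L_ne_zero
        (measure_mono_null (fun ω hω => mem_iUnion.2 ⟨⟨0, hm⟩, hω⟩) h0)
    · exact (hA.indivisible hm).iUnion_shift hap hm hE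
  · rintro _ rfl - i hi
    refine measure_mono_null ?_ (hC.nonatomicTransientStates _ rfl hat i hi)
    intro ω hω n
    obtain ⟨k, hk, hk'⟩ := hω n
    exact ⟨k * m, hk.trans (Nat.le_mul_of_pos_right k hm), by simpa using hk'⟩
  · rw [tsum_singleton C fun D => X.μ (X.L m D), measure_congr hCm.L_ae_eq, measure_univ]

lemma beta_le_period (hap : X.Aperiodic) (hsimple : X.Simple) (hm : 1 ≤ m) :
    X.beta m ≤ X.period := by
  obtain ⟨C, hC⟩ := hsimple.exists_isBlackwell
  have hrep : X.Represents 1 C univ := by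
    have hCL := hC.measure_iUnion_L
    rw [biUnion_singleton] at hCL
    have hae : ∀ᵐ ω ∂X.μ, ω ∈ X.L 1 C :=
      (prob_compl_eq_zero_iff (X.shiftInvariant_L 1 C).1).2 hCL
    filter_upwards [hae] with ω hω
    exact ⟨iff_of_true hω (mem_univ ω), iff_of_true (X.L_subset_U 1 C hω) (mem_univ ω)⟩
  by_cases hat : X.Atomic 1 C
  · have htriv : ∀ E, ShiftInvariant 1 E → X.μ E = 0 ∨ X.μ Eᶜ = 0 := fun E hE => by
      simpa [compl_eq_univ_sdiff] using
        (hat.indivisible one_pos).congr hrep.L_ae_eq E hE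
    obtain ⟨n, F, hF⟩ := exists_isInvariantPartition htriv hm
    obtain ⟨c, hc, hnc, G, hG⟩ := exists_cyclic_family htriv hap hm hF
    have hG' : X.IsInvariantPartition c c G := hG.isInvariantPartition fun ⟨K, hK⟩ =>
      absurd (card_le_of_isInvariantFamily htriv hc hK) (by omega)
    calc X.beta m ≤ n := hF.beta_le hm
      _ ≤ c := by exact_mod_cast hnc
      _ ≤ X.period := le_period hc ((hG'.beta_le hc).antisymm (hG'.le_beta hc))
  · calc X.beta m ≤ ({C} : Set (Set S)).encard :=
          sInf_le (mem_image_of_mem _ (isBlackwell_singleton_of_not_atomic hap hm hC hrep hat))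
      _ = (1 : ℕ) := by simp
      _ ≤ X.period := le_period le_rfl (by simpa [Simple] using hsimple)

end Beta

end MarkovChain

variable {S : Type} [MeasurableSpace S] [MeasurableSingletonClass S]
  [Countable S] [Infinite S]

/-- The asymptotic period of a simple Markov chain `X` satisfies
`d(X) = sup {β(X^(m)) | m ≥ 1}`. -/
theorem stmt8 (X : MarkovChain S) (hirr : X.Irreducible) (hap : X.Aperiodic)
    (hsimple : X.Simple) :
    X.period = sSup {b : ℕ∞ | ∃ m : ℕ, 1 ≤ m ∧ X.beta m = b} := by
  refine le_antisymm (sSup_le_sSup ?_) (sSup_le ?_)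
  · rintro _ ⟨m, hm, hb, rfl⟩
    exact ⟨m, hm, hb⟩
  · rintro _ ⟨m, hm, rfl⟩
    exact MarkovChain.beta_le_period hap hsimple hm
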